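/- Let n ≥ 1 and d ≥ 1 be integers and let α_0, …, α_n be positive integers. Let Δ = { s = (s_0,…,s_{n−1}) ∈ ℝ^n : s_i ≥ 0 for all i, and s_0^d + ⋯ + s_{n−1}^d ≤ 1 }. Then the Lebesgue integral ∫_Δ (∏_{i=0}^{n−1} s_i^{α_i−1}) · (1 − s_0^d − ⋯ − s_{n−1}^d)^{(α_n/d) − 1} ds equals (∏_{i=0}^{n} Γ(α_i/d)) / (d^n · Γ((α_0 + ⋯ + α_n)/d)), where (1 − Σ s_i^d)^{(α_n/d)−1} is the real power and Γ is the Euler gamma function. -/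

import Mathlib

open MeasureTheory

open scoped ENNReal

/-- The function `u ↦ u ^ (b - 1)` on `[0, ∞)`, extended by zero to negative `u`. -/
noncomputable def truncatedRpow (b u : ℝ) : ℝ≥0∞ :=
  if 0 ≤ u then ENNReal.ofReal (u ^ (b - 1)) else 0

@[fun_prop]
lemma measurable_truncatedRpow (b : ℝ) : Measurable (truncatedRpow b) :=
  Measurable.ite measurableSet_Ici (by fun_prop) (by fun_prop)

lemma truncatedRpow_of_nonneg (b : ℝ) {u : ℝ} (hu : 0 ≤ u) :
    truncatedRpow b u = ENNReal.ofReal (u ^ (b - 1)) := if_pos hu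

lemma truncatedRpow_of_neg (b : ℝ) {u : ℝ} (hu : u < 0) : truncatedRpow b u = 0 :=
  if_neg hu.not_ge

/-- The image of the unit interval under `u ↦ (c * u) ^ (1 / p)`. -/
lemma image_mul_rpow_inv_Ioo {p c : ℝ} (hp : 0 < p) (hc : 0 < c) :
    (fun u : ℝ => (c * u) ^ p⁻¹) '' Set.Ioo 0 1 = Set.Ioo 0 (c ^ p⁻¹) := by
  ext s
  constructor
  · rintro ⟨u, ⟨h0, h1⟩, rfl⟩
    refine ⟨by positivity, Real.rpow_lt_rpow (by positivity) ?_ (by positivity)⟩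
    nlinarith
  · rintro ⟨h0, h1⟩
    refine ⟨s ^ p / c, ⟨by positivity, ?_⟩, ?_⟩
    · rw [div_lt_one hc]
      exact (Real.lt_rpow_inv_iff_of_pos h0.le hc.le hp).1 h1
    · simp only
      rw [mul_div_cancel₀ _ hc.ne', Real.rpow_rpow_inv h0.le hp.ne']

/-- A scaled form of Euler's beta integral. -/
lemma lintegral_truncatedRpow_mul_sub_rpow {a b p c : ℝ} (ha : 0 < a) (hb : 0 < b) (hp : 0 < p)
    (hc : c ≠ 0) :
    ∫⁻ s, truncatedRpow a s * truncatedRpow b (c - s ^ p) =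
      ENNReal.ofReal (ProbabilityTheory.beta (a / p) b / p) * truncatedRpow (a / p + b) c := by
  rcases hc.lt_or_gt with hc | hc
  · rw [truncatedRpow_of_neg _ hc, mul_zero, lintegral_eq_zero_iff (by fun_prop)]
    refine Filter.Eventually.of_forall fun s => ?_
    rcases lt_or_ge s 0 with hs | hs
    · simp [truncatedRpow_of_neg _ hs]
    · have : c - s ^ p < 0 := by have := Real.rpow_nonneg hs p; linarith
      simp [truncatedRpow_of_neg _ this]
  · have hB := ProbabilityTheory.beta_pos (div_pos ha hp) hb
    have hsupp : (fun s => truncatedRpow a s * truncatedRpow b (c - s ^ p)) =ᵐ[volume]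
        (Set.Ioo 0 (c ^ p⁻¹)).indicator
          (fun s => truncatedRpow a s * truncatedRpow b (c - s ^ p)) := by
      filter_upwards [Measure.ae_ne volume (0 : ℝ), Measure.ae_ne volume (c ^ p⁻¹)] with s h0 h1
      by_cases hs : s ∈ Set.Ioo 0 (c ^ p⁻¹)
      · rw [Set.indicator_of_mem hs]
      rw [Set.indicator_of_notMem hs]
      rcases h0.lt_or_gt with h0 | h0
      · simp [truncatedRpow_of_neg _ h0]
      · have h2 : c ^ p⁻¹ < s := lt_of_le_of_ne (not_lt.1 fun h => hs ⟨h0, h⟩) h1.symm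
        have : c - s ^ p < 0 := by
          have := (Real.rpow_inv_lt_iff_of_pos hc.le h0.le hp).1 h2
          linarith
        simp [truncatedRpow_of_neg _ this]
    rw [lintegral_congr_ae hsupp, lintegral_indicator measurableSet_Ioo,
      ← image_mul_rpow_inv_Ioo hp hc,
      lintegral_image_eq_lintegral_abs_deriv_mul
        (f' := fun u => c * p⁻¹ * (c * u) ^ (p⁻¹ - 1)) measurableSet_Ioo]
    · rw [truncatedRpow_of_nonneg _ hc.le, ← ENNReal.ofReal_mul (by positivity),
        ← mul_one (ENNReal.ofReal (_ * _)),
        ← ProbabilityTheory.lintegral_betaPDF_eq_one (div_pos ha hp) hb,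
        ProbabilityTheory.lintegral_betaPDF, ← lintegral_const_mul _ (by fun_prop)]
      refine setLIntegral_congr_fun measurableSet_Ioo fun u hu => ?_
      have h0 : 0 < u := hu.1
      have h1 : 0 < 1 - u := by linarith [hu.2]
      have hcu : 0 < c * u := by positivity
      have hd : c - ((c * u) ^ p⁻¹) ^ p = c * (1 - u) := by
        rw [Real.rpow_inv_rpow hcu.le hp.ne']; ring
      rw [hd, truncatedRpow_of_nonneg _ (by positivity), truncatedRpow_of_nonneg _ (by positivity),
        ← ENNReal.ofReal_mul (by positivity), ← ENNReal.ofReal_mul (by positivity),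
        ← ENNReal.ofReal_mul (by positivity), abs_of_pos (by positivity)]
      congr 1
      have e1 : (c * u) ^ (p⁻¹ - 1) * ((c * u) ^ p⁻¹) ^ (a - 1) =
          c ^ (a / p - 1) * u ^ (a / p - 1) := by
        rw [← Real.rpow_mul hcu.le, ← Real.rpow_add hcu, Real.mul_rpow hc.le h0.le]
        congr 2 <;> field_simp <;> ring
      have e2 : c * c ^ (a / p - 1) * c ^ (b - 1) = c ^ (a / p + b - 1) := by
        nth_rewrite 1 [← Real.rpow_one c]
        rw [← Real.rpow_add hc, ← Real.rpow_add hc]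
        congr 1; ring
      rw [Real.mul_rpow hc.le h1.le, ← e2]
      calc _ = c * p⁻¹ * ((c * u) ^ (p⁻¹ - 1) * ((c * u) ^ p⁻¹) ^ (a - 1)) *
            (c ^ (b - 1) * (1 - u) ^ (b - 1)) := by ring
        _ = _ := by rw [e1]; field_simp
    · intro u hu
      have h := ((hasDerivAt_id u).const_mul c).rpow_const (p := p⁻¹)
        (Or.inl (mul_pos hc hu.1).ne')
      simpa using h.hasDerivWithinAt
    · intro u hu v hv h
      have := (Real.rpow_left_inj (mul_pos hc hu.1).le (mul_pos hc hv.1).le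
        (inv_pos.2 hp).ne').1 h
      exact mul_left_cancel₀ hc.ne' this

/-- Tonelli's theorem, splitting off the first coordinate of `Fin (n + 1) → ℝ`. -/
lemma lintegral_fin_succ {n : ℕ} {f : (Fin (n + 1) → ℝ) → ℝ≥0∞} (hf : Measurable f) :
    ∫⁻ s, f s = ∫⁻ x : ℝ, ∫⁻ y : Fin n → ℝ, f (Fin.cons x y) := by
  have he := (volume_preserving_piFinSuccAbove (fun _ : Fin (n + 1) => ℝ) 0).symm
  rw [← he.lintegral_comp_emb (MeasurableEquiv.measurableEmbedding _), Measure.volume_eq_prod,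
    lintegral_prod (fun z => f _) (hf.comp he.measurable).aemeasurable]
  refine lintegral_congr fun x => lintegral_congr fun y => congrArg f ?_
  exact Fin.insertNth_zero (α := fun _ => ℝ) x y

/-- The Dirichlet integral with exponent `p`, over the region `∑ i, s i ^ p ≤ c`. -/
lemma lintegral_prod_truncatedRpow {p : ℝ} (hp : 0 < p) {b : ℝ} (hb : 0 < b) {n : ℕ}
    (a : Fin n → ℝ) (ha : ∀ i, 0 < a i) {c : ℝ} (hc : c ≠ 0) :
    ∫⁻ s : Fin n → ℝ, (∏ i, truncatedRpow (a i) (s i)) * truncatedRpow b (c - ∑ i, s i ^ p) =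
      ENNReal.ofReal ((∏ i, Real.Gamma (a i / p)) * Real.Gamma b /
        (p ^ n * Real.Gamma (∑ i, a i / p + b))) * truncatedRpow (∑ i, a i / p + b) c := by
  induction n generalizing c with
  | zero => simp [volume_pi, (Real.Gamma_pos_of_pos hb).ne']
  | succ n ih =>
    have hS : 0 < ∑ i : Fin n, a i.succ / p + b :=
      add_pos_of_nonneg_of_pos (Finset.sum_nonneg fun i _ => (div_pos (ha _) hp).le) hb
    have hne : ∀ᵐ x : ℝ, x < 0 ∨ c - x ^ p ≠ 0 := by
      filter_upwards [Measure.ae_ne volume (c ^ p⁻¹)] with x hx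
      refine (lt_or_ge x 0).imp_right fun h0 h => hx ?_
      rw [sub_eq_zero.1 h, Real.rpow_rpow_inv h0 hp.ne']
    rw [lintegral_fin_succ (by fun_prop)]
    simp_rw [Fin.prod_univ_succ, Fin.sum_univ_succ, Fin.cons_succ, Fin.cons_zero, mul_assoc,
      ← sub_sub]
    calc _ = ∫⁻ x, ENNReal.ofReal ((∏ i : Fin n, Real.Gamma (a i.succ / p)) * Real.Gamma b /
        (p ^ n * Real.Gamma (∑ i : Fin n, a i.succ / p + b))) *
          (truncatedRpow (a 0) x * truncatedRpow (∑ i : Fin n, a i.succ / p + b) (c - x ^ p)) := by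
          refine lintegral_congr_ae ?_
          filter_upwards [hne] with x hx
          rw [lintegral_const_mul _ (by fun_prop)]
          rcases hx with hx | hx
          · simp [truncatedRpow_of_neg _ hx]
          · rw [ih (fun i => a i.succ) (fun i => ha _) hx]
            ring
      _ = _ := by
          have hΓ := Real.Gamma_pos_of_pos hS
          have hP : 0 < ∏ i : Fin n, Real.Gamma (a i.succ / p) :=
            Finset.prod_pos fun i _ => Real.Gamma_pos_of_pos (div_pos (ha _) hp)
          have hb' := Real.Gamma_pos_of_pos hb
          rw [lintegral_const_mul _ (by fun_prop),
            lintegral_truncatedRpow_mul_sub_rpow (ha 0) hS hp hc, ← mul_assoc,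
            ← ENNReal.ofReal_mul (by positivity), add_assoc, ProbabilityTheory.beta]
          congr 2
          field_simp
          ring

/-- The value of the integral of the Fermat residue form over the real simplex-like
region `Δ = {s : sᵢ ≥ 0, Σ sᵢ^d ≤ 1}`, in terms of the Euler gamma function. -/
theorem fermat_simplex_integral (n d : ℕ) (hn : 1 ≤ n) (hd : 1 ≤ d)
    (α : Fin (n + 1) → ℕ) (hα : ∀ i, 0 < α i) :
    ∫ s in {s : Fin n → ℝ | (∀ i, 0 ≤ s i) ∧ ∑ i, s i ^ d ≤ 1},
        (∏ i : Fin n, s i ^ (α i.castSucc - 1)) *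
          (1 - ∑ i : Fin n, s i ^ d) ^ (((α (Fin.last n) : ℝ)) / d - 1) =
      (∏ i : Fin (n + 1), Real.Gamma ((α i : ℝ) / d)) /
        ((d : ℝ) ^ n * Real.Gamma ((∑ i : Fin (n + 1), (α i : ℝ)) / d)) := by
  have hd' : (0 : ℝ) < d := by exact_mod_cast hd
  have hα' : ∀ i, (0 : ℝ) < α i := fun i => by exact_mod_cast hα i
  have hm : MeasurableSet {s : Fin n → ℝ | (∀ i, 0 ≤ s i) ∧ ∑ i, s i ^ d ≤ 1} := by
    have h0 : MeasurableSet {s : Fin n → ℝ | ∀ i, 0 ≤ s i} := by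
      rw [Set.ofPred_forall]
      exact MeasurableSet.iInter fun i => measurableSet_le (by fun_prop) (by fun_prop)
    have h1 : MeasurableSet {s : Fin n → ℝ | ∑ i, s i ^ d ≤ 1} :=
      measurableSet_le (by fun_prop) (by fun_prop)
    exact h0.inter h1
  rw [integral_eq_lintegral_of_nonneg_ae, ← lintegral_indicator hm]
  · have key := lintegral_prod_truncatedRpow hd' (div_pos (hα' (Fin.last n)) hd')
      (fun i : Fin n => (α i.castSucc : ℝ)) (fun i => hα' _) one_ne_zero
    rw [← Finset.sum_div, ← add_div, ← Fin.sum_univ_castSucc (fun i => (α i : ℝ)),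
      ← Fin.prod_univ_castSucc (fun i => Real.Gamma ((α i : ℝ) / d)),
      truncatedRpow_of_nonneg _ zero_le_one, Real.one_rpow, ENNReal.ofReal_one, mul_one] at key
    trans (ENNReal.ofReal ((∏ i, Real.Gamma ((α i : ℝ) / d)) /
        ((d : ℝ) ^ n * Real.Gamma ((∑ i, (α i : ℝ)) / d)))).toReal
    · rw [← key]
      congr 1
      refine lintegral_congr fun s => ?_
      simp_rw [Real.rpow_natCast]
      by_cases h0 : ∀ i, 0 ≤ s i
      · by_cases h1 : ∑ i, s i ^ d ≤ 1
        · have hs : s ∈ {s : Fin n → ℝ | (∀ i, 0 ≤ s i) ∧ ∑ i, s i ^ d ≤ 1} := ⟨h0, h1⟩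
          rw [Set.indicator_of_mem hs,
            truncatedRpow_of_nonneg _ (sub_nonneg.2 h1),
            ENNReal.ofReal_mul (Finset.prod_nonneg fun i _ => pow_nonneg (h0 i) _),
            ENNReal.ofReal_prod_of_nonneg fun i _ => pow_nonneg (h0 i) _]
          congr 1
          refine Finset.prod_congr rfl fun i _ => ?_
          rw [truncatedRpow_of_nonneg _ (h0 i), ← Real.rpow_natCast, Nat.cast_pred (hα _)]
        · rw [Set.indicator_of_notMem fun h => h1 h.2,
            truncatedRpow_of_neg _ (sub_neg.2 (not_le.1 h1)), mul_zero]
      · rw [Set.indicator_of_notMem fun h => h0 h.1]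
        push Not at h0
        obtain ⟨i, hi⟩ := h0
        rw [Finset.prod_eq_zero (Finset.mem_univ i) (truncatedRpow_of_neg _ hi), zero_mul]
    · refine ENNReal.toReal_ofReal ?_
      refine div_nonneg (Finset.prod_nonneg fun i _ => ?_) (mul_nonneg (by positivity) ?_)
      · exact (Real.Gamma_pos_of_pos (div_pos (hα' i) hd')).le
      · exact Real.Gamma_nonneg_of_nonneg
          (div_nonneg (Finset.sum_nonneg fun i _ => (hα' i).le) hd'.le)
  · refine ae_restrict_of_forall_mem hm fun s hs => ?_
    exact mul_nonneg (Finset.prod_nonneg fun i _ => pow_nonneg (hs.1 i) _)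
      (Real.rpow_nonneg (sub_nonneg.2 hs.2) _)
  · exact Measurable.aestronglyMeasurable (by fun_prop)
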